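/- Let n ≥ 4. The set 𝒯₂ satisfies: (1) 𝒯₁ ⊆ 𝒯₂; (2) SPAN(𝒯₂) is closed under pointwise multiplication, i.e. if u, v ∈ SPAN(𝒯₂) then u·v ∈ SPAN(𝒯₂); (3) for every u ∈ 𝒯₂ and every i ∈ {1,…,n}, the partial derivative ∂u/∂x_i (taken on ℝⁿ∖{0}) belongs to SPAN(𝒯₂). -/

import Mathlib

open Real
open scoped BigOperators

noncomputable section

abbrev E (n : ℕ) := EuclideanSpace ℝ (Fin n)

/-- The Euclidean Laplacian of `f` at `x` (sum of second partial derivatives). -/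
def lap (n : ℕ) (f : E n → ℝ) (x : E n) : ℝ :=
  ∑ i : Fin n, fderiv ℝ (fun y => fderiv ℝ f y (EuclideanSpace.single i 1)) x
    (EuclideanSpace.single i 1)

/-- `f` is a (real) polynomial function on `ℝⁿ`. -/
def IsPolyFun (n : ℕ) (f : E n → ℝ) : Prop :=
  ∃ P : MvPolynomial (Fin n) ℝ, ∀ x : E n, f x = MvPolynomial.eval (fun i => x i) P

/-- `p` is a harmonic homogeneous polynomial of degree `m` on `ℝⁿ`. -/
def IsHHP (n m : ℕ) (p : E n → ℝ) : Prop :=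
  IsPolyFun n p ∧ (∀ (c : ℝ) (x : E n), p (c • x) = c ^ m * p x) ∧ ∀ x : E n, lap n p x = 0

/-- The set `𝒯₁` of leading harmonic terms `|x|^{2-n-2k} p(x)`, `k ≥ 1`. -/
def T1 (n : ℕ) : Set (E n → ℝ) :=
  {f | ∃ (k : ℕ) (p : E n → ℝ), 1 ≤ k ∧ IsHHP n k p ∧
    f = fun x => ‖x‖ ^ ((2:ℝ) - n - 2 * k) * p x}

/-- The set `𝒯₂` of functions `|x|^{(2-n)l-k-m} p(x)`, `k ≥ l ≥ 1`, `k ≥ m`, `k - m` even. -/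
def T2 (n : ℕ) : Set (E n → ℝ) :=
  {f | ∃ (l k m : ℕ) (p : E n → ℝ), IsHHP n m p ∧ 1 ≤ l ∧ l ≤ k ∧ m ≤ k ∧ Even (k - m) ∧
    f = fun x => ‖x‖ ^ (((2:ℝ) - n) * l - k - m) * p x}

/-- The set `𝒯` of functions `|x|^{σ-m} p(x)`, `σ = 2j - (n-2)l - k`,
`k ≥ l ≥ j+1`, `k ≥ m`, `k - m` even. -/
def Tset (n : ℕ) : Set (E n → ℝ) :=
  {f | ∃ (j l k m : ℕ) (p : E n → ℝ), IsHHP n m p ∧ j + 1 ≤ l ∧ l ≤ k ∧ m ≤ k ∧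
    Even (k - m) ∧
    f = fun x => ‖x‖ ^ ((2 * (j:ℝ) - ((n:ℝ) - 2) * l - k) - m) * p x}

/-- The set `𝒯̃` (on `ℝ⁴`) of functions `|x|^{-2l-k-m} (log|x|)^i p(x)`,
`l ≥ 1`, `k ≥ l + i`, `k ≥ m`, `k - m` even. -/
def Ttilde : Set (E 4 → ℝ) :=
  {f | ∃ (l k i m : ℕ) (p : E 4 → ℝ), IsHHP 4 m p ∧ 1 ≤ l ∧ l + i ≤ k ∧ m ≤ k ∧
    Even (k - m) ∧
    f = fun x => ‖x‖ ^ (-(2 * (l:ℝ)) - k - m) * (Real.log ‖x‖) ^ i * p x}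

namespace MvPolynomial

variable {σ : Type*} [Fintype σ]

/-- The algebraic Laplacian `∑ i, ∂ᵢ²` on real polynomials. -/
def laplacian : MvPolynomial σ ℝ →ₗ[ℝ] MvPolynomial σ ℝ :=
  ∑ i, (pderiv i).toLinearMap ∘ₗ (pderiv i).toLinearMap

lemma laplacian_apply (f : MvPolynomial σ ℝ) : laplacian f = ∑ i, pderiv i (pderiv i f) := by
  simp [laplacian]

/-- The polynomial `∑ i, Xᵢ²`. -/
def normSqPoly : MvPolynomial σ ℝ := ∑ i, X i ^ 2

lemma isHomogeneous_normSqPoly : (normSqPoly : MvPolynomial σ ℝ).IsHomogeneous 2 :=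
  IsHomogeneous.sum _ _ _ fun i _ => isHomogeneous_X_pow i 2

lemma pderiv_normSqPoly (i : σ) : pderiv i (normSqPoly : MvPolynomial σ ℝ) = 2 * X i := by
  classical
  simp [normSqPoly, pderiv_X, Pi.single_apply]

lemma IsHomogeneous.laplacian {f : MvPolynomial σ ℝ} {d : ℕ} (hf : f.IsHomogeneous d) :
    (MvPolynomial.laplacian f).IsHomogeneous (d - 2) := by
  rw [laplacian_apply]
  exact IsHomogeneous.sum _ _ _ fun i _ => hf.pderiv.pderiv

lemma IsHomogeneous.pderiv_eq_zero {τ R : Type*} [CommSemiring R] {f : MvPolynomial τ R}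
    (hf : f.IsHomogeneous 0) (i : τ) :
    MvPolynomial.pderiv i f = 0 := by
  rw [totalDegree_eq_zero_iff_eq_C.mp ((totalDegree_zero_iff_isHomogeneous (p := f)).mpr hf),
    pderiv_C]

lemma IsHomogeneous.laplacian_eq_zero {f : MvPolynomial σ ℝ} {d : ℕ} (hf : f.IsHomogeneous d)
    (hd : d < 2) : MvPolynomial.laplacian f = 0 := by
  rw [laplacian_apply]
  refine Finset.sum_eq_zero fun i _ => ?_
  have h := hf.pderiv (i := i)
  rw [show d - 1 = 0 by omega] at h
  exact h.pderiv_eq_zero i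

lemma IsHomogeneous.laplacian_normSqPoly_mul {g : MvPolynomial σ ℝ} {e : ℕ}
    (hg : g.IsHomogeneous e) :
    MvPolynomial.laplacian (normSqPoly * g) =
      (2 * Fintype.card σ + 4 * e : ℝ) • g + normSqPoly * MvPolynomial.laplacian g := by
  have key (i : σ) : pderiv i (pderiv i (normSqPoly * g)) =
      2 * g + 4 * (X i * pderiv i g) + normSqPoly * pderiv i (pderiv i g) := by
    have h2 : pderiv i (2 : MvPolynomial σ ℝ) = 0 := pderiv_C (a := (2 : ℝ))
    simp only [pderiv_mul, map_add, pderiv_normSqPoly, h2, pderiv_X_self]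
    ring
  simp only [laplacian_apply, key, Finset.sum_add_distrib, ← Finset.mul_sum,
    hg.sum_X_mul_pderiv]
  simp only [Finset.sum_const, Finset.card_univ, nsmul_eq_mul, smul_eq_C_mul, map_add, map_mul,
    map_natCast, map_ofNat]
  ring

lemma IsHomogeneous.exists_laplacian_normSqPoly_pow_mul [Nonempty σ] {h : MvPolynomial σ ℝ}
    {e : ℕ} (hh : h.IsHomogeneous e) (hL : MvPolynomial.laplacian h = 0) (j : ℕ) :
    ∃ c : ℝ, 0 < c ∧
      MvPolynomial.laplacian (normSqPoly ^ (j + 1) * h) = c • (normSqPoly ^ j * h) := by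
  have hcard : (0 : ℝ) < Fintype.card σ := by exact_mod_cast Fintype.card_pos
  induction j with
  | zero =>
    refine ⟨2 * Fintype.card σ + 4 * e, by positivity, ?_⟩
    simp [hh.laplacian_normSqPoly_mul, hL]
  | succ j ih =>
    obtain ⟨c, hc, ih⟩ := ih
    have hg := (isHomogeneous_normSqPoly.pow (j + 1)).mul hh
    refine ⟨2 * Fintype.card σ + 4 * (2 * (j + 1) + e : ℕ) + c, by positivity, ?_⟩
    rw [pow_succ' _ (j + 1), mul_assoc, hg.laplacian_normSqPoly_mul, ih, mul_smul_comm,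
      pow_succ' _ j, mul_assoc, ← add_smul]

/-- The polynomials `|X|^{2j} h` of degree `d` with `h` homogeneous and harmonic. -/
def harmonicTerms (σ : Type*) [Fintype σ] (d : ℕ) : Set (MvPolynomial σ ℝ) :=
  {f | ∃ (j e : ℕ) (h : MvPolynomial σ ℝ), h.IsHomogeneous e ∧ laplacian h = 0 ∧ 2 * j + e = d ∧
    f = normSqPoly ^ j * h}

lemma isHomogeneous_of_mem_span_harmonicTerms {d : ℕ} {f : MvPolynomial σ ℝ}
    (hf : f ∈ Submodule.span ℝ (harmonicTerms σ d)) : f.IsHomogeneous d := by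
  rw [← mem_homogeneousSubmodule]
  refine Submodule.span_le.mpr ?_ hf
  rintro _ ⟨j, e, h, hh, -, rfl, rfl⟩
  exact (isHomogeneous_normSqPoly.pow j).mul hh

lemma exists_laplacian_eq_of_mem_span_harmonicTerms [Nonempty σ] {d : ℕ} {f : MvPolynomial σ ℝ}
    (hf : f ∈ Submodule.span ℝ (harmonicTerms σ d)) :
    ∃ g ∈ Submodule.span ℝ (harmonicTerms σ (d + 2)), laplacian g = f := by
  suffices Submodule.span ℝ (harmonicTerms σ d) ≤
      (Submodule.span ℝ (harmonicTerms σ (d + 2))).map laplacian from this hf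
  rw [Submodule.span_le]
  rintro _ ⟨j, e, h, hh, hL, rfl, rfl⟩
  obtain ⟨c, hc, hcL⟩ := hh.exists_laplacian_normSqPoly_pow_mul hL j
  refine ⟨c⁻¹ • (normSqPoly ^ (j + 1) * h), Submodule.smul_mem _ _
    (Submodule.subset_span ⟨j + 1, e, h, hh, hL, by ring, rfl⟩), ?_⟩
  rw [map_smul, hcL, smul_smul, inv_mul_cancel₀ hc.ne', one_smul]

/-- Every homogeneous polynomial is a sum of terms `|X|^{2j} h` with `h` homogeneous harmonic. -/
theorem IsHomogeneous.mem_span_harmonicTerms [Nonempty σ] {d : ℕ} {f : MvPolynomial σ ℝ}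
    (hf : f.IsHomogeneous d) : f ∈ Submodule.span ℝ (harmonicTerms σ d) := by
  induction d using Nat.strong_induction_on generalizing f with
  | _ d ih =>
    have harm {h : MvPolynomial σ ℝ} (hh : h.IsHomogeneous d)
        (hL : MvPolynomial.laplacian h = 0) : h ∈ Submodule.span ℝ (harmonicTerms σ d) :=
      Submodule.subset_span ⟨0, d, h, hh, hL, by simp, by simp⟩
    by_cases hd : d < 2
    · exact harm hf (hf.laplacian_eq_zero hd)
    · obtain ⟨g, hg, hgL⟩ :=
        exists_laplacian_eq_of_mem_span_harmonicTerms (ih (d - 2) (by omega) hf.laplacian)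
      rw [Nat.sub_add_cancel (by omega)] at hg
      rw [← sub_add_cancel f g]
      exact add_mem (harm (hf.sub (isHomogeneous_of_mem_span_harmonicTerms hg))
        (by rw [map_sub, hgL, sub_self])) hg

lemma IsHomogeneous.eval_smul {R τ : Type*} [CommSemiring R] {f : MvPolynomial τ R} {d : ℕ}
    (hf : f.IsHomogeneous d) (c : R) (x : τ → R) : eval (c • x) f = c ^ d * eval x f := by
  rw [eval_eq, eval_eq, Finset.mul_sum]
  refine Finset.sum_congr rfl fun s hs => ?_
  simp only [Pi.smul_apply, smul_eq_mul, mul_pow, Finset.prod_mul_distrib]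
  rw [Finset.prod_pow_eq_pow_sum, ← hf.degree_eq_sum_deg_support hs]
  ring

lemma eval_homogeneousComponent_of_forall_eval_smul {R τ : Type*} [CommRing R] [IsDomain R]
    [Infinite R] {P : MvPolynomial τ R} {m : ℕ} {x : τ → R}
    (h : ∀ c : R, eval (c • x) P = c ^ m * eval x P) :
    eval x (homogeneousComponent m P) = eval x P := by
  have hpoly : ∑ j ∈ Finset.range (P.totalDegree + 1),
      Polynomial.monomial j (eval x (homogeneousComponent j P)) =
      Polynomial.monomial m (eval x P) := by
    refine Polynomial.funext fun c => ?_
    rw [Polynomial.eval_finsetSum, Polynomial.eval_monomial, mul_comm (eval x P), ← h c]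
    conv_rhs => rw [← sum_homogeneousComponent P, map_sum]
    refine Finset.sum_congr rfl fun j _ => ?_
    rw [(homogeneousComponent_isHomogeneous j P).eval_smul, Polynomial.eval_monomial, mul_comm]
  have := congrArg (Polynomial.coeff · m) hpoly
  simp only [Polynomial.finsetSum_coeff, Polynomial.coeff_monomial, Finset.sum_ite_eq',
    Finset.mem_range, if_true] at this
  rw [← this]
  split_ifs with hm
  · rfl
  · rw [homogeneousComponent_eq_zero _ _ (by omega), map_zero]

end MvPolynomial

open MvPolynomial

lemma eval_normSqPoly {n : ℕ} (x : E n) : eval (fun i => x i) normSqPoly = ‖x‖ ^ 2 := by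
  simp [normSqPoly, EuclideanSpace.norm_sq_eq]

lemma hasFDerivAt_mvPolynomial_eval {n : ℕ} (P : MvPolynomial (Fin n) ℝ) (x : E n) :
    HasFDerivAt (fun y : E n => eval (fun i => y i) P)
      (∑ i, eval (fun i => x i) (pderiv i P) • EuclideanSpace.proj (𝕜 := ℝ) i) x := by
  classical
  induction P using MvPolynomial.induction_on with
  | C a => simpa using hasFDerivAt_const a x
  | add p q hp hq =>
    simpa only [map_add, add_smul, Finset.sum_add_distrib] using hp.fun_add hq
  | mul_X p j hp =>
    have hj : HasFDerivAt (fun y : E n => y j) (EuclideanSpace.proj (𝕜 := ℝ) j) x :=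
      (EuclideanSpace.proj (𝕜 := ℝ) j).hasFDerivAt
    simp only [map_mul, eval_X]
    refine (hp.fun_mul hj).congr_fderiv ?_
    ext v
    simp [pderiv_X, Pi.single_apply, add_mul, Finset.sum_add_distrib,
      Finset.mul_sum, apply_ite, ite_mul, mul_assoc]

lemma fderiv_mvPolynomial_eval_single {n : ℕ} (P : MvPolynomial (Fin n) ℝ) (x : E n) (i : Fin n) :
    fderiv ℝ (fun y : E n => eval (fun i => y i) P) x (EuclideanSpace.single i 1) =
      eval (fun i => x i) (pderiv i P) := by
  simp [(hasFDerivAt_mvPolynomial_eval P x).fderiv]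

lemma lap_mvPolynomial_eval {n : ℕ} (P : MvPolynomial (Fin n) ℝ) (x : E n) :
    lap n (fun y => eval (fun i => y i) P) x = eval (fun i => x i) (laplacian P) := by
  simp only [lap, fderiv_mvPolynomial_eval_single, laplacian_apply, map_sum]

lemma MvPolynomial.IsHomogeneous.isHHP {n e : ℕ} {h : MvPolynomial (Fin n) ℝ}
    (hh : h.IsHomogeneous e) (hL : MvPolynomial.laplacian h = 0) :
    IsHHP n e (fun x => eval (fun i => x i) h) :=
  ⟨⟨h, fun _ => rfl⟩, fun c x => hh.eval_smul c fun i => x i,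
    fun x => by rw [lap_mvPolynomial_eval, hL, map_zero]⟩

lemma IsHHP.exists_isHomogeneous {n m : ℕ} {p : E n → ℝ} (hp : IsHHP n m p) :
    ∃ P : MvPolynomial (Fin n) ℝ, P.IsHomogeneous m ∧ p = fun x => eval (fun i => x i) P := by
  obtain ⟨⟨P, hP⟩, hs, -⟩ := hp
  refine ⟨homogeneousComponent m P, homogeneousComponent_isHomogeneous m P, funext fun x => ?_⟩
  rw [eval_homogeneousComponent_of_forall_eval_smul, hP]
  intro c
  rw [← hP, ← hs c x, hP]
  rfl

/-- `|x|^{(2-n)l-k-d} q(x)` agrees off the origin with an element of `SPAN(𝒯₂)` for every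
homogeneous polynomial `q` of degree `d`, harmonic or not. -/
lemma exists_mem_span_T2_of_isHomogeneous {n : ℕ} [NeZero n] {l k d : ℕ} (hl : 1 ≤ l)
    (hlk : l ≤ k) (hdk : d ≤ k) (hev : Even (k - d)) {Q : MvPolynomial (Fin n) ℝ}
    (hQ : Q.IsHomogeneous d) :
    ∃ w ∈ Submodule.span ℝ (T2 n), ∀ x : E n, x ≠ 0 →
      ‖x‖ ^ (((2 : ℝ) - n) * l - k - d) * eval (fun i => x i) Q = w x := by
  have hmem := hQ.mem_span_harmonicTerms
  clear hQ
  induction hmem using Submodule.span_induction with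
  | mem f hf =>
    obtain ⟨j, e, h, hh, hL, rfl, rfl⟩ := hf
    have hev' : Even (k - e) := by
      obtain ⟨r, hr⟩ := hev
      exact ⟨r + j, by omega⟩
    refine ⟨_, Submodule.subset_span
      ⟨l, k, e, _, hh.isHHP hL, hl, hlk, by omega, hev', rfl⟩, fun x hx => ?_⟩
    have hx' : 0 < ‖x‖ := norm_pos_iff.mpr hx
    rw [map_mul, map_pow, eval_normSqPoly, ← mul_assoc, ← pow_mul, ← Real.rpow_natCast,
      ← Real.rpow_add hx']
    congr 2
    push_cast
    ring
  | zero => exact ⟨0, zero_mem _, fun x _ => by simp⟩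
  | add f g _ _ hf hg =>
    obtain ⟨u, hu, hu'⟩ := hf
    obtain ⟨v, hv, hv'⟩ := hg
    refine ⟨u + v, add_mem hu hv, fun x hx => ?_⟩
    rw [map_add, mul_add, hu' x hx, hv' x hx, Pi.add_apply]
  | smul c f _ hf =>
    obtain ⟨u, hu, hu'⟩ := hf
    refine ⟨c • u, Submodule.smul_mem _ _ hu, fun x hx => ?_⟩
    rw [smul_eval, mul_left_comm, hu' x hx, Pi.smul_apply, smul_eq_mul]

lemma T1_subset_T2 (n : ℕ) : T1 n ⊆ T2 n := by
  rintro _ ⟨k, p, hk, hp, rfl⟩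
  refine ⟨1, k, k, p, hp, le_rfl, hk, le_rfl, by simp, ?_⟩
  funext x
  congr 2
  push_cast
  ring

lemma exists_mem_span_T2_mul {n : ℕ} [NeZero n] {u v : E n → ℝ} (hu : u ∈ T2 n) (hv : v ∈ T2 n) :
    ∃ w ∈ Submodule.span ℝ (T2 n), ∀ x : E n, x ≠ 0 → u x * v x = w x := by
  obtain ⟨l, k, m, p, hp, hl, hlk, hmk, hev, rfl⟩ := hu
  obtain ⟨l', k', m', p', hp', hl', hlk', hmk', hev', rfl⟩ := hv
  obtain ⟨P, hP, rfl⟩ := hp.exists_isHomogeneous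
  obtain ⟨P', hP', rfl⟩ := hp'.exists_isHomogeneous
  have hE : Even (k + k' - (m + m')) := by
    rw [show k + k' - (m + m') = (k - m) + (k' - m') by omega]
    exact hev.add hev'
  obtain ⟨w, hw, hw'⟩ := exists_mem_span_T2_of_isHomogeneous (show 1 ≤ l + l' by omega)
    (add_le_add hlk hlk') (add_le_add hmk hmk') hE (hP.mul hP')
  refine ⟨w, hw, fun x hx => ?_⟩
  rw [← hw' x hx, map_mul, mul_mul_mul_comm, ← Real.rpow_add (norm_pos_iff.mpr hx)]
  congr 2
  push_cast
  ring

lemma exists_mem_span_T2_mul_of_mem_span {n : ℕ} [NeZero n] {u v : E n → ℝ}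
    (hu : u ∈ Submodule.span ℝ (T2 n)) (hv : v ∈ Submodule.span ℝ (T2 n)) :
    ∃ w ∈ Submodule.span ℝ (T2 n), ∀ x : E n, x ≠ 0 → u x * v x = w x := by
  induction hu, hv using Submodule.span_induction₂ with
  | mem_mem u v hu hv => exact exists_mem_span_T2_mul hu hv
  | zero_left v hv => exact ⟨0, zero_mem _, by simp⟩
  | zero_right u hu => exact ⟨0, zero_mem _, by simp⟩
  | add_left u₁ u₂ v _ _ _ h₁ h₂ =>
    obtain ⟨w₁, hw₁, h₁⟩ := h₁
    obtain ⟨w₂, hw₂, h₂⟩ := h₂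
    exact ⟨w₁ + w₂, add_mem hw₁ hw₂, fun x hx => by simp [add_mul, h₁ x hx, h₂ x hx]⟩
  | add_right u v₁ v₂ _ _ _ h₁ h₂ =>
    obtain ⟨w₁, hw₁, h₁⟩ := h₁
    obtain ⟨w₂, hw₂, h₂⟩ := h₂
    exact ⟨w₁ + w₂, add_mem hw₁ hw₂, fun x hx => by simp [mul_add, h₁ x hx, h₂ x hx]⟩
  | smul_left c u v _ _ h =>
    obtain ⟨w, hw, h⟩ := h
    exact ⟨c • w, Submodule.smul_mem _ _ hw, fun x hx => by simp [mul_assoc, h x hx]⟩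
  | smul_right c u v _ _ h =>
    obtain ⟨w, hw, h⟩ := h
    exact ⟨c • w, Submodule.smul_mem _ _ hw, fun x hx => by simp [mul_left_comm, h x hx]⟩

lemma hasFDerivAt_norm_rpow_of_ne_zero {F : Type*} [NormedAddCommGroup F] [InnerProductSpace ℝ F]
    {x : F} (hx : x ≠ 0) (a : ℝ) :
    HasFDerivAt (fun y : F => ‖y‖ ^ a) ((a * ‖x‖ ^ (a - 2)) • innerSL ℝ x) x := by
  have hsq (y : F) : ‖y‖ ^ a = (‖y‖ ^ 2) ^ (a / 2) := by
    rw [← Real.rpow_natCast, ← Real.rpow_mul (norm_nonneg y)]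
    congr 1
    push_cast
    ring
  have h := (hasStrictFDerivAt_norm_sq x).hasFDerivAt.rpow_const (p := a / 2)
    (Or.inl (by simpa using hx))
  simp only [← hsq] at h
  convert h using 1
  rw [← Real.rpow_natCast, ← Real.rpow_mul (norm_nonneg x), ← Nat.cast_smul_eq_nsmul ℝ, smul_smul]
  congr 1
  rw [show ((2 : ℕ) : ℝ) * (a / 2 - 1) = a - 2 by push_cast; ring]
  push_cast
  ring

lemma fderiv_norm_rpow_mul_eval_single {n : ℕ} (a : ℝ) (P : MvPolynomial (Fin n) ℝ) {x : E n}
    (hx : x ≠ 0) (i : Fin n) :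
    fderiv ℝ (fun y : E n => ‖y‖ ^ a * eval (fun i => y i) P) x (EuclideanSpace.single i 1) =
      a * (‖x‖ ^ (a - 2) * eval (fun i => x i) (X i * P)) +
        ‖x‖ ^ a * eval (fun i => x i) (pderiv i P) := by
  rw [((hasFDerivAt_norm_rpow_of_ne_zero hx a).fun_mul (hasFDerivAt_mvPolynomial_eval P x)).fderiv]
  simp [EuclideanSpace.inner_single_right]
  ring

lemma exists_mem_span_T2_fderiv {n : ℕ} [NeZero n] {u : E n → ℝ} (hu : u ∈ T2 n) (i : Fin n) :
    ∃ w ∈ Submodule.span ℝ (T2 n),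
      ∀ x : E n, x ≠ 0 → fderiv ℝ u x (EuclideanSpace.single i 1) = w x := by
  obtain ⟨l, k, m, p, hp, hl, hlk, hmk, hev, rfl⟩ := hu
  obtain ⟨P, hP, rfl⟩ := hp.exists_isHomogeneous
  obtain ⟨w₁, hw₁, h₁⟩ := exists_mem_span_T2_of_isHomogeneous (k := k + 1) (d := 1 + m) hl
    (by omega) (by omega) (by rwa [add_comm 1 m, Nat.add_sub_add_right])
    ((isHomogeneous_X ℝ i).mul hP)
  obtain ⟨w₂, hw₂, h₂⟩ : ∃ w ∈ Submodule.span ℝ (T2 n), ∀ x : E n, x ≠ 0 →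
      ‖x‖ ^ (((2 : ℝ) - n) * l - k - m) * eval (fun i => x i) (pderiv i P) = w x := by
    rcases m with _ | m
    · refine ⟨0, zero_mem _, fun x _ => ?_⟩
      simp [hP.pderiv_eq_zero i]
    · obtain ⟨w, hw, h⟩ := exists_mem_span_T2_of_isHomogeneous (k := k + 1) (d := m) hl
        (by omega) (by omega) (by
          rw [show k + 1 - m = (k - (m + 1)) + 2 by omega]
          exact hev.add even_two) (hP.pderiv (i := i))
      refine ⟨w, hw, fun x hx => ?_⟩
      rw [← h x hx]
      congr 2
      push_cast
      ring
  refine ⟨(((2 : ℝ) - n) * l - k - m) • w₁ + w₂,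
    add_mem (Submodule.smul_mem _ _ hw₁) hw₂, fun x hx => ?_⟩
  rw [fderiv_norm_rpow_mul_eval_single _ P hx, h₂ x hx, Pi.add_apply, Pi.smul_apply, ← h₁ x hx,
    smul_eq_mul]
  congr 4
  push_cast
  ring

/-- properties of `𝒯₂` (`n ≥ 4`):
`𝒯₁ ⊆ 𝒯₂`, `SPAN(𝒯₂)` is closed under pointwise multiplication (as functions on
`ℝⁿ∖{0}`), and partial derivatives of elements of `𝒯₂` lie in `SPAN(𝒯₂)`. -/
theorem T2_properties (n : ℕ) (hn : 4 ≤ n) :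
    T1 n ⊆ T2 n ∧
    (∀ u ∈ Submodule.span ℝ (T2 n), ∀ v ∈ Submodule.span ℝ (T2 n),
      ∃ w ∈ Submodule.span ℝ (T2 n), ∀ x : E n, x ≠ 0 → u x * v x = w x) ∧
    (∀ u ∈ T2 n, ∀ i : Fin n, ∃ w ∈ Submodule.span ℝ (T2 n),
      ∀ x : E n, x ≠ 0 → fderiv ℝ u x (EuclideanSpace.single i 1) = w x) := by
  have : NeZero n := ⟨by omega⟩
  exact ⟨T1_subset_T2 n, fun _ hu _ hv => exists_mem_span_T2_mul_of_mem_span hu hv,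
    fun _ hu i => exists_mem_span_T2_fderiv hu i⟩
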